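/- Let 0 < β < 1, 𝔼 > 0, t > 0, and let g : [0, t] → ℝ be continuous. Then (1/2) ∫₀^∞ Ẽ_β(z) · (∫₀^t exp(−(t − s)/z) g(s) ds)² dz = (𝔼 / (2 Γ(1 − β))) · ∫₀^t ∫₀^t g(s₁) g(s₂) · (2t − s₁ − s₂)^{−β} ds₁ ds₂, where Ẽ_β(z) = 𝔼 / (Γ(1 − β) Γ(β) z^{β+1}). -/

import Mathlib

open MeasureTheory Set

lemma aux_int (β c : ℝ) (hβ : 0 < β) (hc : 0 < c) :
    IntegrableOn (fun z : ℝ => z ^ (-(β+1)) * Real.exp (-c / z)) (Ioi 0) ∧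
    ∫ z in Ioi (0:ℝ), z ^ (-(β+1)) * Real.exp (-c / z) = Real.Gamma β * c ^ (-β) := by
  have key : ∀ x ∈ Ioi (0:ℝ), (|(-1:ℝ)| * x ^ ((-1:ℝ) - 1)) • ((x ^ (-1:ℝ)) ^ (β - 1) *
      Real.exp (-(c * x ^ (-1:ℝ)))) = x ^ (-(β+1)) * Real.exp (-c / x) := by
    intro x hx
    have hx : 0 < x := hx
    rw [smul_eq_mul, ← Real.rpow_mul hx.le, abs_neg, abs_one, one_mul, ← mul_assoc,
      ← Real.rpow_add hx, Real.rpow_neg_one]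
    congr 2 <;> ring
  constructor
  · have h := integrableOn_rpow_mul_exp_neg_mul_rpow (p := 1) (s := β - 1) (b := c)
      (by linarith) one_pos hc
    have h2 : IntegrableOn (fun y : ℝ => y ^ (β - 1) * Real.exp (-(c * y))) (Ioi 0) := by
      simpa [neg_mul] using h
    rw [← integrableOn_Ioi_comp_rpow_iff _ (p := -1) (by norm_num)] at h2
    exact h2.congr_fun key measurableSet_Ioi
  · rw [← setIntegral_congr_fun measurableSet_Ioi key,
      integral_comp_rpow_Ioi (fun y : ℝ => y ^ (β - 1) * Real.exp (-(c * y))) (by norm_num),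
      Real.integral_rpow_mul_exp_neg_mul_Ioi hβ hc, one_div, Real.inv_rpow hc.le,
      Real.rpow_neg hc.le, mul_comm]



/-- For `0 < β < 1`, `𝔼 > 0`, `t > 0` and `g` continuous on `[0,t]`,
`(1/2) ∫₀^∞ Ẽ_β(z) (∫₀^t exp(-(t-s)/z) g(s) ds)² dz
  = (𝔼/(2Γ(1-β))) ∫₀^t ∫₀^t g(s₁) g(s₂) (2t-s₁-s₂)^{-β} ds₁ ds₂`,
where `Ẽ_β(z) = 𝔼/(Γ(1-β) Γ(β) z^{β+1})`. -/
theorem stmt2 (β E t : ℝ) (hβ : β ∈ Set.Ioo (0 : ℝ) 1) (hE : 0 < E) (ht : 0 < t)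
    (g : ℝ → ℝ) (hg : ContinuousOn g (Set.Icc 0 t)) :
    (1 / 2) * (∫ z in Set.Ioi (0 : ℝ),
        (E / (Real.Gamma (1 - β) * Real.Gamma β * z ^ (β + 1))) *
          (∫ s in (0 : ℝ)..t, Real.exp (-(t - s) / z) * g s) ^ 2)
      = (E / (2 * Real.Gamma (1 - β))) *
          ∫ s₂ in (0 : ℝ)..t, ∫ s₁ in (0 : ℝ)..t,
            g s₁ * g s₂ * (2 * t - s₁ - s₂) ^ (-β) := by

  obtain ⟨hβ0, hβ1⟩ := hβ
  set ν : Measure ℝ := volume.restrict (Ioo 0 t) with hν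
  have conv : ∀ f : ℝ → ℝ, ∫ s in (0:ℝ)..t, f s = ∫ s, f s ∂ν := fun f => by
    rw [intervalIntegral.integral_of_le ht.le, integral_Ioc_eq_integral_Ioo]
  simp only [conv]
  obtain ⟨M, hM⟩ := isCompact_Icc.exists_bound_of_continuousOn hg
  have hgm : AEStronglyMeasurable g ν :=
    (hg.mono Ioo_subset_Icc_self).aestronglyMeasurable measurableSet_Ioo
  have hP : ∀ᵐ p ∂(ν.prod ν), p.1 ∈ Ioo 0 t ∧ p.2 ∈ Ioo 0 t := by
    rw [hν, Measure.prod_restrict]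
    filter_upwards [ae_restrict_mem (measurableSet_Ioo.prod measurableSet_Ioo)] with p hp
    exact hp
  have hgg : AEStronglyMeasurable (fun p : ℝ × ℝ => g p.2 * g p.1) (ν.prod ν) :=
    hgm.comp_snd.mul hgm.comp_fst
  have hdom : Integrable (fun a : ℝ => (t - a) ^ (-β)) ν := by
    have h := (intervalIntegral.intervalIntegrable_rpow' (a := 0) (b := t) (r := -β)
      (by linarith)).comp_sub_left t
    simp only [sub_zero, sub_self] at h
    have h2 := h.symm
    rw [intervalIntegrable_iff_integrableOn_Ioo_of_le ht.le] at h2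
    exact h2
  have hK : Integrable (fun p : ℝ × ℝ => g p.2 * g p.1 * (2 * t - p.2 - p.1) ^ (-β))
      (ν.prod ν) := by
    have hd : Integrable (fun p : ℝ × ℝ => (t - p.1) ^ (-β) * (M * M)) (ν.prod ν) :=
      hdom.mul_prod (integrable_const (M * M))
    refine hd.mono' (hgg.mul (Measurable.aestronglyMeasurable (by fun_prop))) ?_
    filter_upwards [hP] with p hp
    obtain ⟨h1, h2⟩ := hp
    have b1 := hM _ (Ioo_subset_Icc_self h1)
    have b2 := hM _ (Ioo_subset_Icc_self h2)
    have hpos : 0 < t - p.1 := by linarith [h1.2]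
    have hle : t - p.1 ≤ 2 * t - p.2 - p.1 := by linarith [h2.2]
    rw [norm_mul, norm_mul, mul_comm, Real.norm_of_nonneg (Real.rpow_nonneg (hpos.le.trans hle) _)]
    have hM0 : 0 ≤ M := (norm_nonneg _).trans b1
    exact mul_le_mul (Real.rpow_le_rpow_of_nonpos hpos hle (by linarith))
      (mul_le_mul b2 b1 (norm_nonneg _) hM0) (by positivity) (by positivity)
  set F : ℝ → ℝ × ℝ → ℝ := fun z p =>
    (z ^ (-(β+1)) * Real.exp (-(2 * t - p.2 - p.1) / z)) * (g p.2 * g p.1) with hF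
  have hFi : Integrable (Function.uncurry F) ((volume.restrict (Ioi (0:ℝ))).prod (ν.prod ν)) := by
    have hmeas : AEStronglyMeasurable (Function.uncurry F)
        ((volume.restrict (Ioi (0:ℝ))).prod (ν.prod ν)) := by
      refine AEStronglyMeasurable.mul (Measurable.aestronglyMeasurable ?_) hgg.comp_snd
      fun_prop
    rw [integrable_prod_iff' hmeas]
    constructor
    · filter_upwards [hP] with p hp
      exact (aux_int β (2 * t - p.2 - p.1) hβ0 (by linarith [hp.1.2, hp.2.2])).1.mul_const (g p.2 * g p.1)
    · refine (hK.norm.const_mul (Real.Gamma β)).congr ?_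
      filter_upwards [hP] with p hp
      have hc : 0 < 2 * t - p.2 - p.1 := by linarith [hp.1.2, hp.2.2]
      have e : ∀ z ∈ Ioi (0:ℝ), ‖Function.uncurry F (z, p)‖ =
          (z ^ (-(β+1)) * Real.exp (-(2 * t - p.2 - p.1) / z)) * ‖g p.2 * g p.1‖ := by
        intro z hz
        have hz : 0 < z := hz
        simp only [Function.uncurry, hF]
        rw [norm_mul, Real.norm_of_nonneg (by positivity)]
      rw [setIntegral_congr_fun measurableSet_Ioi e, integral_mul_const, (aux_int β _ hβ0 hc).2,
        norm_mul (g p.2 * g p.1), Real.norm_of_nonneg (Real.rpow_nonneg hc.le _)]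
      ring
  have hL : ∀ z ∈ Ioi (0:ℝ), (E / (Real.Gamma (1 - β) * Real.Gamma β * z ^ (β + 1))) *
          (∫ s, Real.exp (-(t - s) / z) * g s ∂ν) ^ 2 =
      (E / (Real.Gamma (1 - β) * Real.Gamma β)) * ∫ p, F z p ∂(ν.prod ν) := by
    intro z hz
    have hz : 0 < z := hz
    have e : ∀ p : ℝ × ℝ, F z p = z ^ (-(β+1)) * ((Real.exp (-(t - p.1) / z) * g p.1) *
        (Real.exp (-(t - p.2) / z) * g p.2)) := by
      intro p
      have : -(2 * t - p.2 - p.1) / z = -(t - p.1) / z + -(t - p.2) / z := by ring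
      simp only [hF]
      rw [this, Real.exp_add]
      ring
    simp only [e]
    rw [integral_const_mul, integral_prod_mul (fun s => Real.exp (-(t - s) / z) * g s)
      (fun s => Real.exp (-(t - s) / z) * g s), Real.rpow_neg hz.le, ← div_div]
    ring
  rw [setIntegral_congr_fun measurableSet_Ioi hL, integral_const_mul, integral_integral_swap hFi]
  have hR : ∫ p, (∫ z in Ioi (0:ℝ), F z p) ∂(ν.prod ν) =
      ∫ p, Real.Gamma β * (g p.2 * g p.1 * (2 * t - p.2 - p.1) ^ (-β)) ∂(ν.prod ν) := by
    refine integral_congr_ae ?_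
    filter_upwards [hP] with p hp
    have hc : 0 < 2 * t - p.2 - p.1 := by linarith [hp.1.2, hp.2.2]
    simp only [hF]
    rw [integral_mul_const, (aux_int β _ hβ0 hc).2]
    ring
  rw [hR, integral_const_mul, integral_prod _ hK]
  have g1 := (Real.Gamma_pos_of_pos hβ0).ne'
  have g2 := (Real.Gamma_pos_of_pos (sub_pos.2 hβ1)).ne'
  field_simp
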